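/- A positive integer p is the period of some factor of r = τ(φ^ω(0)) with exponent at least 5/2 (i.e., some factor w with period p and 2·|w| ≥ 5·p occurring in some τ(φ^n(0))) if and only if p = P_m + P_{m-1} for some integer m ≥ 3, where (P_m) are the Pell numbers. -/

import Mathlib

/-- Extension of a morphism (given on letters) to finite words by concatenation. -/
def applyM {α β : Type*} (h : α → List β) (w : List α) : List β := w.flatMap h

/-- The morphism φ on the alphabet {0,1,2}: φ(0)=01, φ(1)=02, φ(2)=022. -/
def phim : Fin 3 → List (Fin 3) := ![[0,1],[0,2],[0,2,2]]

/-- The morphism τ to the binary alphabet: τ(0)=0, τ(1)=01, τ(2)=011. -/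
def taum : Fin 3 → List (Fin 2) := ![[0],[0,1],[0,1,1]]

/-- `phipow n w` is the word φ^n(w). -/
def phipow (n : ℕ) (w : List (Fin 3)) : List (Fin 3) := (applyM phim)^[n] w

/-- `p` is a period of the finite word `w`: `1 ≤ p ≤ |w|` and `w[i] = w[i+p]`
for all valid indices. -/
def IsPeriod {α : Type*} (w : List α) (p : ℕ) : Prop :=
  0 < p ∧ p ≤ w.length ∧ ∀ i : ℕ, i + p < w.length → w[i]? = w[i+p]?

/-- The Pell numbers: P₀ = 0, P₁ = 1, Pₙ = 2·Pₙ₋₁ + Pₙ₋₂. -/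
def pell : ℕ → ℕ
  | 0 => 0
  | 1 => 1
  | (n+2) => 2 * pell (n+1) + pell n

section Morphism

variable {α β : Type*}

theorem applyM_append (h : α → List β) (v w : List α) :
    applyM h (v ++ w) = applyM h v ++ applyM h w := by
  simp [applyM]

theorem applyM_cons (h : α → List β) (c : α) (w : List α) :
    applyM h (c :: w) = h c ++ applyM h w := by
  simp [applyM]

theorem applyM_nil (h : α → List β) : applyM h [] = [] := rfl

theorem phipow_append (n : ℕ) (v w : List (Fin 3)) :
    phipow n (v ++ w) = phipow n v ++ phipow n w := by
  induction n generalizing v w with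
  | zero => rfl
  | succ n ih =>
    simp only [phipow, Function.iterate_succ, Function.comp_apply] at ih ⊢
    rw [applyM_append, ih]

theorem phipow_succ (n : ℕ) (w : List (Fin 3)) :
    phipow (n + 1) w = applyM phim (phipow n w) := by
  simp [phipow, Function.iterate_succ_apply']

theorem phipow_phipow (m n : ℕ) (w : List (Fin 3)) :
    phipow m (phipow n w) = phipow (m + n) w := by
  simp [phipow, Function.iterate_add_apply]

/-- If every block `h c` consists of a marker `o` followed by letters other than `o`, then an
occurrence of `o` in an image starts a block. -/
theorem exists_split_of_applyM_eq {h : α → List β} {o : β} {g : α → List β}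
    (hh : ∀ c, h c = o :: g c) (ho : ∀ c, o ∉ g c) (W : List α) (X Y : List β)
    (e : applyM h W = X ++ o :: Y) :
    ∃ W₁ W₂, W = W₁ ++ W₂ ∧ applyM h W₁ = X ∧ applyM h W₂ = o :: Y := by
  induction W generalizing X with
  | nil => simp [applyM] at e
  | cons c W ih =>
    cases X with
    | nil => exact ⟨[], c :: W, rfl, rfl, e⟩
    | cons x X =>
      rw [applyM_cons, hh, List.cons_append, List.cons_append, List.cons.injEq] at e
      obtain ⟨rfl, e⟩ := e
      rcases List.append_eq_append_iff.1 e with ⟨t, rfl, e'⟩ | ⟨t, e', e''⟩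
      · obtain ⟨W₁, W₂, rfl, h₁, h₂⟩ := ih t e'
        exact ⟨c :: W₁, W₂, rfl, by rw [applyM_cons, hh, h₁]; rfl, h₂⟩
      · cases t with
        | nil =>
          refine ⟨[c], W, rfl, ?_, by simpa using e''.symm⟩
          simp [applyM_cons, applyM_nil, hh, e']
        | cons y t =>
          rw [List.cons_append, List.cons.injEq] at e''
          exact absurd (by rw [e', e''.1]; simp) (ho c)

theorem exists_suffix_of_append_eq {o : β} {X G A l : List β} (e : X ++ o :: G = A ++ l)
    (hl : o ∉ l) : ∃ y, G = y ++ l ∧ A = X ++ o :: y := by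
  rcases List.append_eq_append_iff.1 e with ⟨t, rfl, e'⟩ | ⟨t, rfl, e'⟩
  · cases t with
    | nil => exact absurd (by rw [← (show o :: G = l by simpa using e')]; simp) hl
    | cons y t =>
      rw [List.cons_append, List.cons.injEq] at e'
      obtain ⟨rfl, rfl⟩ := e'
      exact ⟨t, rfl, rfl⟩
  · exact absurd (by rw [e']; simp) hl

theorem exists_lcp (C C' : List α) : ∃ z B B', C = z ++ B ∧ C' = z ++ B' ∧
    (B = [] ∨ B' = [] ∨ B.head? ≠ B'.head?) := by
  induction C generalizing C' with
  | nil => exact ⟨[], [], C', rfl, rfl, Or.inl rfl⟩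
  | cons c C ih =>
    cases C' with
    | nil => exact ⟨[], c :: C, [], rfl, rfl, Or.inr (Or.inl rfl)⟩
    | cons d C' =>
      by_cases h : c = d
      · obtain ⟨z, B, B', rfl, rfl, hB⟩ := ih C'
        exact ⟨c :: z, B, B', rfl, by rw [h]; rfl, hB⟩
      · exact ⟨[], c :: C, d :: C', rfl, rfl, Or.inr (Or.inr (by simpa using h))⟩

/-- Two occurrences of `z` in `V`, after the prefixes `A` and `A'`, which cannot be extended
simultaneously to the left or to the right. -/
structure MaxRepeat (V A A' z B B' : List α) : Prop where
  eq_left : V = A ++ z ++ B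
  eq_right : V = A' ++ z ++ B'
  length_lt : A.length < A'.length
  left_max : A = [] ∨ A.getLast? ≠ A'.getLast?
  right_max : B = [] ∨ B' = [] ∨ B.head? ≠ B'.head?

theorem exists_maxRepeat (V A A' z B B' : List α) (h₁ : V = A ++ z ++ B)
    (h₂ : V = A' ++ z ++ B') (hlt : A.length < A'.length) :
    ∃ X X' y Y Y', MaxRepeat V X X' y Y Y' ∧ X'.length + A.length = A'.length + X.length ∧
      z.length ≤ y.length := by
  obtain ⟨r, B₁, B₁', rfl, rfl, hB⟩ := exists_lcp B B'
  obtain ⟨l, A₁, A₁', hA, hA', hm⟩ := exists_lcp A.reverse A'.reverse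
  have eA : A = A₁.reverse ++ l.reverse := by rw [← List.reverse_append, ← hA]; simp
  have eA' : A' = A₁'.reverse ++ l.reverse := by rw [← List.reverse_append, ← hA']; simp
  subst eA eA'
  simp only [List.length_append, List.length_reverse] at hlt
  refine ⟨A₁.reverse, A₁'.reverse, l.reverse ++ z ++ r, B₁, B₁', ⟨by simp [h₁], by simp [h₂],
    by simpa using hlt, ?_, hB⟩, by simp; omega, by simp; omega⟩
  rcases hm with h | h | h
  · simp [h]
  · simp [h] at hlt
  · right; simpa using h

/-- Desubstitution of a maximal repeat of `z = l ++ o :: q`, for a morphism all of whose blocks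
start with a marker `o`. -/
theorem MaxRepeat.desubst {h : α → List β} {o : β} {g : α → List β}
    (hh : ∀ c, h c = o :: g c) (ho : ∀ c, o ∉ g c) {W : List α} {A A' z B B' : List β}
    (H : MaxRepeat (applyM h W) A A' z B B') (hz : o ∈ z) :
    ∃ A₁ A₁' z₁ B₁ B₁' l r, MaxRepeat W A₁ A₁' z₁ B₁ B₁' ∧ z = l ++ applyM h z₁ ++ r ∧
      o ∉ l ∧ applyM h A₁ = A ++ l ∧ applyM h A₁' = A' ++ l ∧
      applyM h B₁ = r ++ B ∧ applyM h B₁' = r ++ B' := by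
  obtain ⟨l, q, rfl, hl⟩ := List.eq_append_cons_of_mem hz
  obtain ⟨h₁, h₂, hlt, hL, hR⟩ := H
  obtain ⟨A₁, C, rfl, eA, eC⟩ := exists_split_of_applyM_eq hh ho _ (A ++ l) (q ++ B)
    (by rw [h₁]; simp)
  obtain ⟨A₁', C', eW, eA', eC'⟩ := exists_split_of_applyM_eq hh ho _ (A' ++ l) (q ++ B')
    (by rw [h₂]; simp)
  obtain ⟨z₁, B₁, B₁', rfl, rfl, hm⟩ := exists_lcp C C'
  have hlen : A₁.length < A₁'.length := by
    by_contra! hcon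
    obtain ⟨t, ht⟩ : A₁' <+: A₁ :=
      List.prefix_of_prefix_length_le ⟨_, eW.symm⟩ ⟨_, rfl⟩ hcon
    have := congrArg List.length (congrArg (applyM h) ht)
    simp only [applyM_append, eA, eA', List.length_append] at this
    omega
  have hlast : A₁ = [] ∨ A₁.getLast? ≠ A₁'.getLast? := by
    rcases List.eq_nil_or_concat A₁ with rfl | ⟨X, c, rfl⟩
    · exact Or.inl rfl
    rcases List.eq_nil_or_concat A₁' with rfl | ⟨X', d, rfl⟩
    · simp at hlen
    right
    intro hcd
    simp only [List.concat_eq_append, List.getLast?_concat, Option.some.injEq] at hcd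
    subst hcd
    simp only [List.concat_eq_append, applyM_append, applyM_cons, applyM_nil, hh,
      List.append_nil] at eA eA'
    obtain ⟨y, e, rfl⟩ := exists_suffix_of_append_eq eA hl
    obtain ⟨y', e', rfl⟩ := exists_suffix_of_append_eq eA' hl
    obtain rfl : y = y' := List.append_cancel_right (e.symm.trans e')
    simp [List.getLast?_append, List.getLast?_cons] at hL
  have key : ∃ r, o :: q = applyM h z₁ ++ r := by
    rw [applyM_append, ← List.cons_append] at eC eC'
    rcases List.append_eq_append_iff.1 eC with ⟨t, e, -⟩ | ⟨t, e, e'⟩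
    · exact ⟨t, e⟩
    · rw [e, List.append_assoc, List.append_cancel_left_eq] at eC'
      cases t with
      | nil => exact ⟨[], by simp [e]⟩
      | cons c t => rw [e', ← eC'] at hR; simp at hR
  obtain ⟨r, hr⟩ := key
  rw [applyM_append, ← List.cons_append, hr, List.append_assoc,
    List.append_cancel_left_eq] at eC eC'
  exact ⟨A₁, A₁', z₁, B₁, B₁', l, r, ⟨by simp, by simp [eW], hlen, hlast, hm⟩, by simp [hr], hl,
    eA, eA', eC, eC'⟩

end Morphism

/-- The weight of a word when the letters `0`, `1`, `2` weigh `a`, `b`, `a + b`. -/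
def wt (a b : ℕ) (w : List (Fin 3)) : ℕ := (w.map ![a, b, a + b]).sum

theorem wt_append (a b : ℕ) (v w : List (Fin 3)) : wt a b (v ++ w) = wt a b v + wt a b w := by
  simp [wt]

theorem wt_cons (a b : ℕ) (c : Fin 3) (w : List (Fin 3)) :
    wt a b (c :: w) = ![a, b, a + b] c + wt a b w := by
  simp [wt]

theorem wt_nil (a b : ℕ) : wt a b [] = 0 := rfl

theorem wt_applyM_phim (a b : ℕ) (w : List (Fin 3)) :
    wt a b (applyM phim w) = wt (a + b) (2 * a + b) w := by
  induction w with
  | nil => rfl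
  | cons c w ih =>
    rw [applyM_cons, wt_append, wt_cons, ih]
    congr 1
    fin_cases c <;> simp [phim, wt] <;> omega

theorem length_applyM_taum (w : List (Fin 3)) : (applyM taum w).length = wt 1 2 w := by
  induction w with
  | nil => rfl
  | cons c w ih =>
    rw [applyM_cons, List.length_append, wt_cons, ih]
    congr 1
    fin_cases c <;> simp [taum]

/-- Twice the total length by which the images of a repeat extend to its left, plus one,
in terms of the pair of letters preceding the two occurrences. -/
def leftWt (a b : ℕ) : Option (Fin 3) → Option (Fin 3) → ℕ
  | some x, some y => if x = 1 ∧ y = 2 ∨ x = 2 ∧ y = 1 then a + b else a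
  | _, _ => 1

/-- Twice the total length by which the images of a repeat extend to its right, plus one,
in terms of the pair of letters following the two occurrences. -/
def rightWt (a b : ℕ) : Option (Fin 3) → Option (Fin 3) → ℕ
  | some x, some y => if x = 1 ∧ y = 2 ∨ x = 2 ∧ y = 1 then a + 2 * b else a + b
  | _, _ => 1

theorem phim_eq_cons (c : Fin 3) : phim c = 0 :: (phim c).tail := by
  fin_cases c <;> rfl

theorem zero_notMem_tail_phim (c : Fin 3) : (0 : Fin 3) ∉ (phim c).tail := by
  fin_cases c <;> simp [phim]

theorem taum_eq_cons (c : Fin 3) : taum c = 0 :: (taum c).tail := by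
  fin_cases c <;> rfl

theorem zero_notMem_tail_taum (c : Fin 3) : (0 : Fin 2) ∉ (taum c).tail := by
  fin_cases c <;> simp [taum]

theorem getLast?_append_cons {α : Type*} (X y : List α) (o : α) :
    (X ++ o :: y).getLast? = (o :: y).getLast? := by
  simp [List.getLast?_append, List.getLast?_cons]

theorem leftWt_desubst_phim (a b : ℕ) {W A₁ A₁' z₁ B₁ B₁' A A' l : List (Fin 3)}
    (H : MaxRepeat W A₁ A₁' z₁ B₁ B₁') (hA : applyM phim A₁ = A ++ l)
    (hA' : applyM phim A₁' = A' ++ l) (hl : 0 ∉ l) (hm : A = [] ∨ A.getLast? ≠ A'.getLast?) :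
    leftWt a b A.getLast? A'.getLast? + 2 * wt a b l ≤
      leftWt (a + b) (2 * a + b) A₁.getLast? A₁'.getLast? := by
  obtain ⟨-, -, hlt, hm₁, -⟩ := H
  rcases List.eq_nil_or_concat A₁ with rfl | ⟨X, c, rfl⟩
  · obtain ⟨rfl, rfl⟩ := List.append_eq_nil_iff.1 hA.symm
    simp [leftWt, wt]
  rcases List.eq_nil_or_concat A₁' with rfl | ⟨X', d, rfl⟩
  · simp at hlt
  simp only [List.concat_eq_append, applyM_append, applyM_cons, applyM_nil,
    List.append_nil] at hA hA'
  rw [phim_eq_cons] at hA hA'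
  obtain ⟨y, e, rfl⟩ := exists_suffix_of_append_eq hA hl
  obtain ⟨y', e', rfl⟩ := exists_suffix_of_append_eq hA' hl
  simp only [getLast?_append_cons] at hm ⊢
  simp only [List.concat_eq_append, List.getLast?_concat] at hm₁ ⊢
  clear hA hA' hlt
  fin_cases c <;> fin_cases d <;> simp [phim, List.cons_eq_append_iff] at e e' hm hm₁ <;>
    (first
      | (rcases e with ⟨rfl, rfl⟩ | ⟨rfl, rfl⟩)
      | (rcases e with ⟨rfl, rfl⟩ | ⟨_, rfl, ⟨rfl, rfl⟩ | ⟨rfl, rfl⟩⟩)) <;>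
    simp at e' <;> (try obtain rfl := e') <;> simp at hm <;> simp [leftWt, wt] <;> omega

theorem leftWt_desubst_taum {W A₁ A₁' z₁ B₁ B₁' : List (Fin 3)} {A A' l : List (Fin 2)}
    (H : MaxRepeat W A₁ A₁' z₁ B₁ B₁') (hA : applyM taum A₁ = A ++ l)
    (hA' : applyM taum A₁' = A' ++ l) (hl : 0 ∉ l) (hm : A = [] ∨ A.getLast? ≠ A'.getLast?) :
    1 + 2 * l.length ≤ leftWt 1 2 A₁.getLast? A₁'.getLast? := by
  obtain ⟨-, -, hlt, hm₁, -⟩ := H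
  rcases List.eq_nil_or_concat A₁ with rfl | ⟨X, c, rfl⟩
  · obtain ⟨rfl, rfl⟩ := List.append_eq_nil_iff.1 hA.symm
    simp [leftWt]
  rcases List.eq_nil_or_concat A₁' with rfl | ⟨X', d, rfl⟩
  · simp at hlt
  simp only [List.concat_eq_append, applyM_append, applyM_cons, applyM_nil,
    List.append_nil] at hA hA'
  rw [taum_eq_cons] at hA hA'
  obtain ⟨y, e, rfl⟩ := exists_suffix_of_append_eq hA hl
  obtain ⟨y', e', rfl⟩ := exists_suffix_of_append_eq hA' hl
  simp only [getLast?_append_cons] at hm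
  simp only [List.concat_eq_append, List.getLast?_concat] at hm₁ ⊢
  clear hA hA' hlt
  fin_cases c <;> fin_cases d <;> simp [taum, List.cons_eq_append_iff] at e e' hm hm₁ <;>
    (first
      | (rcases (e : _ ∨ _) with ⟨rfl, rfl⟩ | ⟨rfl, rfl⟩)
      | (rcases e with ⟨rfl, rfl⟩ | ⟨_, rfl, ⟨rfl, rfl⟩ | ⟨rfl, rfl⟩⟩)) <;>
    (try simp at e') <;> (try obtain rfl := e') <;> (try simp at hm) <;> simp [leftWt, *]

theorem applyM_eq_nil_or_cons {β : Type*} {h : Fin 3 → List β} {o : β} {g : Fin 3 → List β}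
    (hh : ∀ c, h c = o :: g c) (w : List (Fin 3)) : applyM h w = [] ∨ ∃ t, applyM h w = o :: t := by
  cases w with
  | nil => exact Or.inl rfl
  | cons c w => right; rw [applyM_cons, hh]; exact ⟨_, rfl⟩

theorem rightWt_desubst_phim {a : ℕ} (b : ℕ) (ha : 0 < a) {B₁ B₁' B B' r : List (Fin 3)}
    (hm₁ : B₁ = [] ∨ B₁' = [] ∨ B₁.head? ≠ B₁'.head?) (hB : applyM phim B₁ = r ++ B)
    (hB' : applyM phim B₁' = r ++ B') (hm : B = [] ∨ B' = [] ∨ B.head? ≠ B'.head?) :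
    rightWt a b B.head? B'.head? + 2 * wt a b r ≤
      rightWt (a + b) (2 * a + b) B₁.head? B₁'.head? := by
  cases B₁ with
  | nil =>
    obtain ⟨rfl, rfl⟩ := List.append_eq_nil_iff.1 hB.symm
    simp [rightWt, wt]
  | cons c S =>
    cases B₁' with
    | nil =>
      obtain ⟨rfl, rfl⟩ := List.append_eq_nil_iff.1 hB'.symm
      cases B <;> simp [rightWt, wt]
    | cons d T =>
      rw [applyM_cons] at hB hB'
      have hS := applyM_eq_nil_or_cons phim_eq_cons S
      have hT := applyM_eq_nil_or_cons phim_eq_cons T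
      generalize applyM phim S = S at hB hS
      generalize applyM phim T = T at hB' hT
      rcases hS with rfl | ⟨S, rfl⟩ <;> rcases hT with rfl | ⟨T, rfl⟩ <;>
        rcases r with _ | ⟨x, _ | ⟨y, _ | ⟨z, r⟩⟩⟩ <;> fin_cases c <;> fin_cases d <;>
        simp [phim] at hB hB' hm₁
      all_goals first
        | (subst hB hB'; simp at hm)
        | (obtain ⟨rfl, rfl⟩ := hB
           obtain ⟨-, rfl⟩ := hB'
           simp [rightWt, wt]
           omega)
        | (obtain ⟨rfl, rfl, rfl⟩ := hB
           obtain ⟨-, h, rfl⟩ := hB'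
           simp at h
           done)
        | (obtain ⟨rfl, rfl, rfl⟩ := hB
           obtain ⟨-, -, rfl⟩ := hB'
           simp [rightWt, wt] at hm ⊢
           omega)
        | grind

theorem rightWt_desubst_taum {B₁ B₁' : List (Fin 3)} {B B' r : List (Fin 2)}
    (hm₁ : B₁ = [] ∨ B₁' = [] ∨ B₁.head? ≠ B₁'.head?) (hB : applyM taum B₁ = r ++ B)
    (hB' : applyM taum B₁' = r ++ B') (hm : B = [] ∨ B' = [] ∨ B.head? ≠ B'.head?) :
    1 + 2 * r.length ≤ rightWt 1 2 B₁.head? B₁'.head? := by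
  cases B₁ with
  | nil =>
    obtain ⟨rfl, rfl⟩ := List.append_eq_nil_iff.1 hB.symm
    simp [rightWt]
  | cons c S =>
    cases B₁' with
    | nil =>
      obtain ⟨rfl, rfl⟩ := List.append_eq_nil_iff.1 hB'.symm
      simp [rightWt]
    | cons d T =>
      rw [applyM_cons] at hB hB'
      have hS := applyM_eq_nil_or_cons taum_eq_cons S
      have hT := applyM_eq_nil_or_cons taum_eq_cons T
      generalize applyM taum S = S at hB hS
      generalize applyM taum T = T at hB' hT
      rcases hS with rfl | ⟨S, rfl⟩ <;> rcases hT with rfl | ⟨T, rfl⟩ <;>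
        rcases r with _ | ⟨x, _ | ⟨y, _ | ⟨z, r⟩⟩⟩ <;> fin_cases c <;> fin_cases d <;>
        simp [taum] at hB hB' hm₁ <;> simp [rightWt] <;> grind

theorem eq_zero_or_of_pair_infix_applyM_phim {x y : Fin 3} (w : List (Fin 3))
    (h : [x, y] <:+: applyM phim w) : x = 0 ∨ y = 0 ∨ x = 2 ∧ y = 2 := by
  induction w with
  | nil => simp [applyM] at h
  | cons c w ih =>
    rw [applyM_cons] at h
    have hw := applyM_eq_nil_or_cons phim_eq_cons w
    generalize applyM phim w = L at h ih hw
    rcases hw with rfl | ⟨t, rfl⟩ <;> fin_cases c <;>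
      simp [phim, List.infix_cons_iff] at h ih <;> grind

theorem not_222_infix_applyM_phim (w : List (Fin 3)) : ¬ [2, 2, 2] <:+: applyM phim w := by
  induction w with
  | nil => simp [applyM]
  | cons c w ih =>
    rw [applyM_cons]
    have hw := applyM_eq_nil_or_cons phim_eq_cons w
    generalize applyM phim w = L at ih hw
    rcases hw with rfl | ⟨t, rfl⟩ <;> fin_cases c <;>
      simp [phim, List.infix_cons_iff] at ih ⊢ <;> grind

theorem eq_zero_or_of_pair_infix_phipow {x y : Fin 3} (k : ℕ) (h : [x, y] <:+: phipow k [0]) :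
    x = 0 ∨ y = 0 ∨ x = 2 ∧ y = 2 := by
  cases k with
  | zero => simpa [phipow] using h.length_le
  | succ k => exact eq_zero_or_of_pair_infix_applyM_phim _ (phipow_succ k _ ▸ h)

theorem not_222_infix_phipow (k : ℕ) : ¬ [2, 2, 2] <:+: phipow k [0] := by
  cases k with
  | zero => exact fun h => by simpa [phipow] using h.length_le
  | succ k => exact phipow_succ k _ ▸ not_222_infix_applyM_phim _

theorem pair_infix_append {α : Type*} {A C : List α} {x y : α} (hx : A.getLast? = some x)
    (hy : C.head? = some y) : [x, y] <:+: A ++ C := by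
  obtain ⟨X, rfl⟩ := List.getLast?_eq_some_iff.1 hx
  obtain ⟨Y, rfl⟩ := List.head?_eq_some_iff.1 hy
  exact ⟨X, Y, by simp⟩

theorem leftWt_le_add (a b : ℕ) (ha : 0 < a) (o o' : Option (Fin 3)) :
    leftWt a b o o' ≤ a + b := by
  unfold leftWt
  split
  · split_ifs <;> omega
  · omega

theorem rightWt_le_add (a b : ℕ) (ha : 0 < a) (o o' : Option (Fin 3)) :
    rightWt a b o o' ≤ a + 2 * b := by
  unfold rightWt
  split
  · split_ifs <;> omega
  · omega

theorem leftWt_le {a : ℕ} (b : ℕ) (ha : 0 < a) {o o' : Option (Fin 3)}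
    (h : ¬ (o = some 1 ∧ o' = some 2 ∨ o = some 2 ∧ o' = some 1)) : leftWt a b o o' ≤ a := by
  unfold leftWt
  split
  · rw [if_neg (by simpa using h)]
  · exact ha

theorem rightWt_le {a : ℕ} (b : ℕ) (ha : 0 < a) {o o' : Option (Fin 3)}
    (h : ¬ (o = some 1 ∧ o' = some 2 ∨ o = some 2 ∧ o' = some 1)) :
    rightWt a b o o' ≤ a + b := by
  unfold rightWt
  split
  · rw [if_neg (by simpa using h)]
  · omega

theorem pell_add_two (n : ℕ) : pell (n + 2) = 2 * pell (n + 1) + pell n := rfl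

theorem pell_succ_pos (n : ℕ) : 0 < pell (n + 1) := by
  induction n with
  | zero => decide
  | succ n ih => rw [pell_add_two]; omega

theorem pell_le_succ (n : ℕ) : pell n ≤ pell (n + 1) := by
  cases n with
  | zero => decide
  | succ n => rw [pell_add_two]; omega

theorem mul_length_le_wt {a b : ℕ} (hab : a ≤ b) (w : List (Fin 3)) : a * w.length ≤ wt a b w := by
  induction w with
  | nil => simp
  | cons c w ih =>
    rw [wt_cons, List.length_cons, mul_add_one]
    fin_cases c <;> simp <;> omega

/-- A maximal repeat without the letter `0`, whose iterated images are long compared to its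
period, has period word `0` or `2`. -/
theorem MaxRepeat.exists_pell_of_zero_notMem {V A A' z B B' : List (Fin 3)}
    (hadj : ∀ x y, [x, y] <:+: V → x = 0 ∨ y = 0 ∨ x = 2 ∧ y = 2) (h222 : ¬ [2, 2, 2] <:+: V)
    (H : MaxRepeat V A A' z B B') (hz : 0 ∉ z) {n a b p : ℕ} (ha : a = pell (n + 1) + pell n)
    (hb : b = 2 * pell (n + 1)) (hp : wt a b A' = wt a b A + p)
    (hle : 3 * p + 2 ≤ 2 * wt a b z + leftWt a b A.getLast? A'.getLast? +
      rightWt a b B.head? B'.head?) :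
    ∃ m, 3 ≤ m ∧ p = pell m + pell (m - 1) := by
  obtain ⟨h₁, h₂, hlt, -, -⟩ := H
  have hP := pell_succ_pos n
  have hPP := pell_le_succ n
  have ha0 : 0 < a := by omega
  have hab : a ≤ b := by omega
  have hba : b ≤ 2 * a := by omega
  obtain ⟨u, rfl⟩ : A <+: A' :=
    List.prefix_of_prefix_length_le (l₃ := V) ⟨z ++ B, by simp [h₁]⟩ ⟨z ++ B', by simp [h₂]⟩ hlt.le
  obtain rfl : p = wt a b u := by rw [wt_append] at hp; omega
  have hu : z ++ B = u ++ (z ++ B') := by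
    have := h₁.symm.trans h₂
    simpa using this
  have hu0 : u ≠ [] := by rintro rfl; simp at hlt
  have hlen := mul_length_le_wt hab u
  have pa : wt a b u = a → 3 * a + 2 ≤ 2 * a + b →
      ∃ m, 3 ≤ m ∧ wt a b u = pell m + pell (m - 1) := by
    intro e h
    rcases n with _ | _ | n
    · simp [pell] at ha hb; omega
    · simp [pell] at ha hb; omega
    · exact ⟨n + 3, by omega, by rw [e, ha]; rfl⟩
  have pab : wt a b u = a + b → 3 * (a + b) + 2 ≤ 4 * a + 3 * b →
      ∃ m, 3 ≤ m ∧ wt a b u = pell m + pell (m - 1) := by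
    intro e h
    rcases n with _ | n
    · simp [pell] at ha hb; omega
    · refine ⟨n + 3, by omega, ?_⟩
      rw [e, ha, hb, show n + 3 - 1 = n + 2 from rfl, pell_add_two (n + 1), pell_add_two n]
      ring
  have hL : ∀ x y, A.getLast? = some x → (z ++ B).head? = some y →
      x = 0 ∨ y = 0 ∨ x = 2 ∧ y = 2 := fun x y hx hy =>
    hadj x y (by rw [h₁, List.append_assoc]; exact pair_infix_append hx hy)
  have hL' : ∀ x y, (A ++ u).getLast? = some x → (z ++ B').head? = some y →
      x = 0 ∨ y = 0 ∨ x = 2 ∧ y = 2 := fun x y hx hy =>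
    hadj x y (by rw [h₂, List.append_assoc]; exact pair_infix_append hx hy)
  have hR : ∀ x y, (A ++ z).getLast? = some x → B.head? = some y →
      x = 0 ∨ y = 0 ∨ x = 2 ∧ y = 2 := fun x y hx hy =>
    hadj x y (by rw [h₁]; exact pair_infix_append hx hy)
  have hR' : ∀ x y, (A ++ u ++ z).getLast? = some x → B'.head? = some y →
      x = 0 ∨ y = 0 ∨ x = 2 ∧ y = 2 := fun x y hx hy =>
    hadj x y (by rw [h₂]; exact pair_infix_append hx hy)
  have hzB : z ++ B <:+: V := ⟨A, [], by simp [h₁]⟩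
  rcases eq_or_ne z [] with rfl | hz0
  · simp only [List.nil_append, List.append_nil, wt_nil] at *
    have hsum : leftWt a b A.getLast? (A ++ u).getLast? + rightWt a b B.head? B'.head? ≤
        2 * a + 2 * b := by
      have h := leftWt_le_add a b ha0 A.getLast? (A ++ u).getLast?
      have h' := rightWt_le_add a b ha0 B.head? B'.head?
      by_cases hA : A.getLast? = some 1
      · have := rightWt_le b ha0 (o := B.head?) (o' := B'.head?) (by grind)
        omega
      · by_cases hA' : (A ++ u).getLast? = some 1
        · have := rightWt_le b ha0 (o := B.head?) (o' := B'.head?) (by grind)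
          omega
        · have := leftWt_le b ha0 (o := A.getLast?) (o' := (A ++ u).getLast?) (by grind)
          omega
    rcases u with _ | ⟨c, _ | ⟨d, u⟩⟩
    · exact absurd rfl hu0
    · subst hu
      simp only [wt_cons, wt_nil, add_zero, List.getLast?_concat, List.cons_append,
        List.nil_append, List.head?_cons] at *
      fin_cases c
      · have := leftWt_le b ha0 (o := A.getLast?) (o' := some 0) (by simp)
        have := rightWt_le b ha0 (o := some 0) (o' := B'.head?) (by simp)
        exact pa rfl (by simp at *; omega)
      · have := leftWt_le b ha0 (o := A.getLast?) (o' := some 1) (by grind)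
        have := rightWt_le b ha0 (o := some 1) (o' := B'.head?) (by grind)
        simp at *
        omega
      · simp at *
        omega
    · simp only [List.length_cons] at hlen
      nlinarith
  · obtain ⟨q, x, hq⟩ : ∃ q x, z = q ++ [x] := by
      simpa using (List.eq_nil_or_concat z).resolve_left hz0
    obtain ⟨y, t, hy⟩ := List.exists_cons_of_ne_nil hz0
    have hx0 : x ≠ 0 := by rintro rfl; simp [hq] at hz
    have hy0 : y ≠ 0 := by rintro rfl; simp [hy] at hz
    have hlw : leftWt a b A.getLast? (A ++ u).getLast? ≤ a := by
      have := fun x h => hL x y h (by simp [hy])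
      have := fun x h => hL' x y h (by simp [hy])
      exact leftWt_le b ha0 (by grind)
    have hrw : rightWt a b B.head? B'.head? ≤ a + b := by
      have := hR x 1 (by simp [hq])
      have := hR' x 1 (by rw [hq, ← List.append_assoc]; simp)
      exact rightWt_le b ha0 (by grind)
    clear hq hL hL' hR hR' hz0 hx0
    subst hy
    obtain ⟨v, u, rfl⟩ := List.exists_cons_of_ne_nil hu0
    simp only [List.cons_append, List.cons.injEq] at hu hzB
    obtain ⟨rfl, hu⟩ := hu
    rcases t with _ | ⟨w, t⟩
    · rcases u with _ | ⟨d, u⟩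
      · simp only [List.nil_append] at hu
        subst hu
        have := hadj y y (List.IsInfix.trans ⟨[], B', rfl⟩ hzB)
        obtain rfl : y = 2 := by grind
        exact pab (by simp [wt]) (by simp [wt] at *; omega)
      · have := mul_length_le_wt hab u
        fin_cases y <;> fin_cases d <;> simp [wt_cons, wt_nil] at * <;> omega
    · have h₃ := hadj y w (List.IsInfix.trans ⟨[], t ++ B, rfl⟩ hzB)
      obtain ⟨rfl, rfl⟩ : y = 2 ∧ w = 2 := by grind
      rcases t with _ | ⟨d, t⟩
      · rcases u with _ | ⟨d, _ | ⟨e, u⟩⟩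
        · simp at hu
          exact absurd (List.IsInfix.trans ⟨[], B', by simp [hu]⟩ hzB) h222
        · simp at hu
          exact absurd (List.IsInfix.trans ⟨[], 2 :: B', by simp [hu.2]⟩ hzB) h222
        · have := mul_length_le_wt hab u
          fin_cases d <;> fin_cases e <;> simp [wt_cons, wt_nil] at * <;> omega
      · have h₄ := hadj 2 d (List.IsInfix.trans ⟨[2], t ++ B, rfl⟩ hzB)
        obtain rfl : d = 2 := by grind
        exact absurd (List.IsInfix.trans ⟨[], t ++ B, rfl⟩ hzB) h222

theorem MaxRepeat.exists_pell_of_phipow {k : ℕ} {A A' z B B' : List (Fin 3)}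
    (H : MaxRepeat (phipow k [0]) A A' z B B') {n a b p : ℕ} (ha : a = pell (n + 1) + pell n)
    (hb : b = 2 * pell (n + 1)) (hp : wt a b A' = wt a b A + p)
    (hle : 3 * p + 2 ≤ 2 * wt a b z + leftWt a b A.getLast? A'.getLast? +
      rightWt a b B.head? B'.head?) :
    ∃ m, 3 ≤ m ∧ p = pell m + pell (m - 1) := by
  induction k generalizing A A' z B B' n a b with
  | zero =>
    refine H.exists_pell_of_zero_notMem (fun _ _ => eq_zero_or_of_pair_infix_phipow 0)
      (not_222_infix_phipow 0) ?_ ha hb hp hle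
    have h := congrArg List.length H.eq_right
    have h' := H.length_lt
    simp only [phipow, Function.iterate_zero, id, List.length_append, List.length_singleton] at h
    simp [List.length_eq_zero_iff.1 (show z.length = 0 by omega)]
  | succ k ih =>
    by_cases hz : 0 ∈ z
    · rw [phipow_succ] at H
      obtain ⟨A₁, A₁', z₁, B₁, B₁', l, r, H₁, rfl, hl, eA, eA', eB, eB'⟩ :=
        H.desubst phim_eq_cons zero_notMem_tail_phim hz
      have hL := leftWt_desubst_phim a b H₁ eA eA' hl H.left_max
      have hR := rightWt_desubst_phim (a := a) b (by have := pell_succ_pos n; omega)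
        H₁.right_max eB eB' H.right_max
      refine ih H₁ (n := n + 1) (a := a + b) (b := 2 * a + b)
        (by rw [pell_add_two]; omega) (by rw [pell_add_two]; omega) ?_ ?_
      · rw [← wt_applyM_phim, ← wt_applyM_phim, eA, eA', wt_append, wt_append]
        omega
      · simp only [wt_append, wt_applyM_phim] at hle
        omega
    · exact H.exists_pell_of_zero_notMem (fun _ _ => eq_zero_or_of_pair_infix_phipow _)
        (not_222_infix_phipow _) hz ha hb hp hle

theorem not_111_infix_applyM_taum (w : List (Fin 3)) : ¬ [1, 1, 1] <:+: applyM taum w := by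
  induction w with
  | nil => simp [applyM]
  | cons c w ih =>
    rw [applyM_cons]
    have hw := applyM_eq_nil_or_cons taum_eq_cons w
    generalize applyM taum w = L at ih hw
    rcases hw with rfl | ⟨t, rfl⟩ <;> fin_cases c <;>
      simp [taum, List.infix_cons_iff] at ih ⊢ <;> grind

theorem MaxRepeat.exists_pell_of_taum {n p : ℕ} {A A' z B B' : List (Fin 2)}
    (H : MaxRepeat (applyM taum (phipow n [0])) A A' z B B') (hp : A'.length = A.length + p)
    (hle : 3 * p ≤ 2 * z.length) : ∃ m, 3 ≤ m ∧ p = pell m + pell (m - 1) := by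
  have hz : 0 ∈ z := by
    by_contra hz
    have h111 := not_111_infix_applyM_taum (phipow n [0])
    have h₁ := H.eq_left
    have h₂ := H.eq_right
    have hlt := H.length_lt
    have hone : ∀ x ∈ z, x = 1 := by grind
    rcases z with _ | ⟨x, _ | ⟨y, _ | ⟨w, t⟩⟩⟩
    · simp at hle; omega
    · simp at hle; omega
    · obtain rfl : x = 1 := hone _ (by simp)
      obtain rfl : y = 1 := hone _ (by simp)
      obtain rfl : p = 1 := by simp at hle; omega
      obtain ⟨u, rfl⟩ : A <+: A' :=
        List.prefix_of_prefix_length_le ⟨_, (h₁.trans (List.append_assoc ..)).symm⟩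
          ⟨_, (h₂.trans (List.append_assoc ..)).symm⟩ hlt.le
      obtain ⟨v, rfl⟩ := List.length_eq_one_iff.1 (show u.length = 1 by simpa using hp)
      have e := h₁.symm.trans h₂
      simp only [List.append_assoc, List.cons_append, List.nil_append,
        List.append_cancel_left_eq, List.cons.injEq] at e
      exact h111 ⟨A, B', by rw [h₁, e.2.2]; simp⟩
    · obtain rfl : x = 1 := hone _ (by simp)
      obtain rfl : y = 1 := hone _ (by simp)
      obtain rfl : w = 1 := hone _ (by simp)
      exact h111 ⟨A, t ++ B, by rw [h₁]; simp⟩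
  obtain ⟨A₁, A₁', z₁, B₁, B₁', l, r, H₁, rfl, hl, eA, eA', eB, eB'⟩ :=
    H.desubst taum_eq_cons zero_notMem_tail_taum hz
  have hL := leftWt_desubst_taum H₁ eA eA' hl H.left_max
  have hR := rightWt_desubst_taum H₁.right_max eB eB' H.right_max
  refine H₁.exists_pell_of_phipow (n := 0) (a := 1) (b := 2) rfl rfl ?_ ?_
  · rw [← length_applyM_taum, ← length_applyM_taum, eA, eA', List.length_append,
      List.length_append]
    omega
  · simp only [List.length_append, length_applyM_taum] at hle
    omega

theorem isPeriod_of_append {α : Type*} {s t v x y : List α} (hs : v = x ++ s) (ht : v = t ++ y)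
    (hv : v ≠ []) : IsPeriod (s ++ v ++ v ++ t) v.length := by
  refine ⟨List.length_pos_iff.2 hv, by simp; omega, fun i hi => ?_⟩
  have hpre : s ++ v ++ v ++ t = (s ++ v ++ t) ++ (y ++ t) := by
    conv_lhs => rw [List.append_assoc (s ++ v)]; enter [2, 1]; rw [ht]
    simp
  have hsuf : s ++ v ++ v ++ t = (s ++ x) ++ (s ++ v ++ t) := by
    conv_lhs => enter [1, 1, 2]; rw [hs]
    simp
  have hlen : v.length = (s ++ x).length := by rw [hs]; simp [add_comm]
  have hi' : i < (s ++ v ++ t).length := by simp at hi ⊢; omega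
  conv_lhs => rw [hpre, List.getElem?_append_left hi']
  rw [hsuf, hlen, List.getElem?_append_right (Nat.le_add_left _ _), Nat.add_sub_cancel]

theorem applyM_infix {α β : Type*} (h : α → List β) {v w : List α} (H : v <:+: w) :
    applyM h v <:+: applyM h w := by
  obtain ⟨s, t, rfl⟩ := H
  exact ⟨applyM h s, applyM h t, by simp [applyM_append]⟩

theorem phipow_infix (n : ℕ) {v w : List (Fin 3)} (H : v <:+: w) :
    phipow n v <:+: phipow n w := by
  obtain ⟨s, t, rfl⟩ := H
  exact ⟨phipow n s, phipow n t, by simp [phipow_append]⟩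

theorem wt_phipow (n : ℕ) (w : List (Fin 3)) :
    wt 1 2 (phipow n w) = wt (pell (n + 1) + pell n) (2 * pell (n + 1)) w := by
  induction n generalizing w with
  | zero => rfl
  | succ n ih =>
    have : phipow (n + 1) w = phipow n (applyM phim w) := rfl
    rw [this, ih, wt_applyM_phim, pell_add_two]
    congr 1 <;> omega

theorem exists_isPeriod_of_three_le {m : ℕ} (hm : 3 ≤ m) :
    ∃ (n : ℕ) (w : List (Fin 2)), w <:+: applyM taum (phipow n [0]) ∧
      IsPeriod w (pell m + pell (m - 1)) ∧ 5 * (pell m + pell (m - 1)) ≤ 2 * w.length := by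
  obtain rfl | rfl | ⟨j, rfl⟩ : m = 3 ∨ m = 4 ∨ ∃ j, m = j + 5 := by
    rcases (by omega : m = 3 ∨ m = 4 ∨ 5 ≤ m) with h | h | h
    · exact .inl h
    · exact .inr (.inl h)
    · exact .inr (.inr ⟨m - 5, by omega⟩)
  · refine ⟨4, ((applyM taum (phipow 4 [0])).drop 14).take 18,
      (List.take_prefix _ _).isInfix.trans (List.drop_suffix _ _).isInfix, ?_, by decide⟩
    have h : ∀ i < 11, (((applyM taum (phipow 4 [0])).drop 14).take 18)[i]? =
      (((applyM taum (phipow 4 [0])).drop 14).take 18)[i + 7]? := by decide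
    refine ⟨by decide, by decide, fun i hi => h i ?_⟩
    change i + 7 < 18 at hi
    omega
  · refine ⟨5, ((applyM taum (phipow 5 [0])).drop 33).take 43,
      (List.take_prefix _ _).isInfix.trans (List.drop_suffix _ _).isInfix, ?_, by decide⟩
    have h : ∀ i < 26, (((applyM taum (phipow 5 [0])).drop 33).take 43)[i]? =
      (((applyM taum (phipow 5 [0])).drop 33).take 43)[i + 17]? := by decide
    refine ⟨by decide, by decide, fun i hi => h i ?_⟩
    change i + 17 < 43 at hi
    omega
  · have hs : phipow 4 [0] = (phipow 4 [0]).take 13 ++ phipow 2 [2] := by decide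
    have ht : phipow 4 [0] = phipow 2 [0] ++ (phipow 4 [0]).drop 4 := by decide
    have hy : phipow 2 [2] ++ phipow 4 [0] ++ phipow 4 [0] ++ phipow 2 [0] <:+:
        phipow 6 [0] := ⟨(phipow 6 [0]).take 42, (phipow 6 [0]).drop 96, by decide⟩
    have image_eq {v x y : List (Fin 3)} (h : v = x ++ y) : applyM taum (phipow j v) =
        applyM taum (phipow j x) ++ applyM taum (phipow j y) := by
      rw [h, phipow_append, applyM_append]
    have hlen (u : List (Fin 3)) : (applyM taum (phipow j u)).length =
        wt (pell (j + 1) + pell j) (2 * pell (j + 1)) u := by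
      rw [length_applyM_taum, wt_phipow]
    have hp : (applyM taum (phipow j (phipow 4 [0]))).length =
        pell (j + 5) + pell (j + 5 - 1) := by
      rw [length_applyM_taum, phipow_phipow, wt_phipow]
      simp [wt, pell_add_two]
    rw [← hp]
    refine ⟨j + 6, _, ?_, isPeriod_of_append (image_eq hs) (image_eq ht) ?_, ?_⟩
    · simpa only [phipow_append, applyM_append, phipow_phipow] using
        applyM_infix taum (phipow_infix j hy)
    · refine List.ne_nil_of_length_pos ?_
      rw [hp]
      have : 0 < pell (j + 5) := pell_succ_pos (j + 4)
      omega
    · have h2 : phipow 2 [2] = [0, 1, 0, 2, 2, 0, 2, 2] := by decide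
      have h0 : phipow 2 [0] = [0, 1, 0, 2] := by decide
      have h4 : phipow 4 [0] =
        [0, 1, 0, 2, 0, 1, 0, 2, 2, 0, 1, 0, 2, 0, 1, 0, 2, 2, 0, 2, 2] := by decide
      simp only [List.length_append, hlen, h2, h0, h4]
      simp [wt]
      linarith

theorem stmt10 (p : ℕ) (hp : 0 < p) :
    (∃ (n : ℕ) (w : List (Fin 2)),
        w <:+: applyM taum (phipow n [0]) ∧ IsPeriod w p ∧ 5 * p ≤ 2 * w.length) ↔
    (∃ m : ℕ, 3 ≤ m ∧ p = pell m + pell (m-1)) := by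
  constructor
  · rintro ⟨n, w, ⟨X, Y, hw⟩, ⟨-, hpw, hper⟩, hle⟩
    have hw' : w.take (w.length - p) = w.drop p := by
      apply List.ext_getElem?
      intro i
      rw [List.getElem?_drop, List.getElem?_take]
      split_ifs with hi
      · rw [hper i (by omega), add_comm]
      · rw [eq_comm, List.getElem?_eq_none_iff]
        omega
    obtain ⟨A, A', z, B, B', H, hp', hz⟩ := exists_maxRepeat (applyM taum (phipow n [0])) X
      (X ++ w.take p) (w.drop p) (w.drop (w.length - p) ++ Y) Y
      (by rw [← hw, ← hw']; simp [← List.append_assoc (List.take _ _)])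
      (by rw [← hw]; simp) (by simp; omega)
    simp only [List.length_append, List.length_take, List.length_drop] at hp' hz
    exact H.exists_pell_of_taum (by omega) (by omega)
  · rintro ⟨m, hm, rfl⟩
    exact exists_isPeriod_of_three_le hm
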